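/- Let k ≥ 0, ℓ ≥ 1, λ ∈ P_ℓ^k and z an integer with 1 ≤ z ≤ bot_λ, and suppose λ_z > λ_{z+1} whenever z ≤ bot_λ − 1. Then there exists a finitely supported family of integers (b_μ) indexed by μ ∈ P_ℓ^k, with b_μ = 0 unless μ_x = λ_x for all x ∈ [1, z], such that ĝ_λ^{(z+1)} = ∑_{μ ∈ P_ℓ^k} b_μ · ĝ_μ^{(z)} and (−1)^{|λ|−|μ|} · b_μ ≥ 0 for every μ. -/

import Mathlib

open scoped Classical

noncomputable section

/-- The ambient ring: formal power series over ℚ in countably many variables. -/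
abbrev R : Type := MvPowerSeries ℕ ℚ

/-- The complete homogeneous symmetric function `h_m` (equal to `0` for `m < 0`):
its coefficient at a monomial is `1` if the monomial has total degree `m`, else `0`. -/
def hh (m : ℤ) : R := fun d => if ((d.sum fun _ e => (e : ℤ)) = m) then 1 else 0

/-- The inhomogeneous analogue `k_m^{(r)} = ∑_{i=0}^{m} C(r+i−1, i) · h_{m−i}`. -/
def kk (r : ℕ) (m : ℤ) : R :=
  ∑ i ∈ Finset.range (m.toNat + 1), ((r + i - 1).choose i : ℚ) • hh (m - (i : ℤ))

/-- The dual stable Grothendieck polynomial `g_γ`, as an `ℓ × ℓ` determinant with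
`(i,j)` entry `k_{γ_i + j − i}^{(i−1)}` (indices 1-based). -/
def gg (ℓ : ℕ) (γ : ℕ → ℤ) : R :=
  (Matrix.of fun i j : Fin ℓ =>
    kk i.val (γ (i.val + 1) + (j.val : ℤ) - (i.val : ℤ))).det

/-- The `i`-th standard basis vector `ε_i`. -/
def eps (i : ℕ) : ℕ → ℤ := fun x => if x = i then 1 else 0

/-- The Katalan function `K(Ψ; M; γ)`. -/
def katalan (ℓ : ℕ) (Ψ : Finset (ℕ × ℕ)) (M : Multiset ℕ) (γ : ℕ → ℤ) : R :=
  (M.powerset.map fun S =>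
    (-1 : R) ^ Multiset.card S *
      ∑ᶠ α : {p // p ∈ Ψ} → ℕ,
        gg ℓ (fun x =>
          γ x + (∑ p ∈ Ψ.attach, (α p : ℤ) * (eps p.1.1 x - eps p.1.2 x))
            - (S.map fun z => eps z x).sum)).sum

/-- The set of positive roots `Δ_ℓ^+ = {(i,j) : 1 ≤ i < j ≤ ℓ}`. -/
def DeltaPlus (ℓ : ℕ) : Finset (ℕ × ℕ) :=
  (Finset.Icc 1 ℓ ×ˢ Finset.Icc 1 ℓ).filter fun p => p.1 < p.2

/-- A root ideal: an upper order ideal of `Δ_ℓ^+`. -/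
def IsRootIdeal (ℓ : ℕ) (Ψ : Finset (ℕ × ℕ)) : Prop :=
  Ψ ⊆ DeltaPlus ℓ ∧
    ∀ a b c d : ℕ, (a, b) ∈ Ψ → (c, d) ∈ DeltaPlus ℓ → c ≤ a → b ≤ d → (c, d) ∈ Ψ

/-- The root ideal `Δ^k(λ) = {(i,j) ∈ Δ_ℓ^+ : j > k − λ_i + i}`. -/
def DeltaK (k ℓ : ℕ) (lam : ℕ → ℤ) : Finset (ℕ × ℕ) :=
  (DeltaPlus ℓ).filter fun p => (k : ℤ) - lam p.1 + (p.1 : ℤ) < (p.2 : ℤ)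

/-- `bot(Ψ)`: the largest `x` such that row `x` of `Ψ` is nonempty (`0` if `Ψ = ∅`). -/
def botIdeal (Ψ : Finset (ℕ × ℕ)) : ℕ := Ψ.sup Prod.fst

/-- `bot_λ := bot(Δ^k(λ))`. -/
def botL (k ℓ : ℕ) (lam : ℕ → ℤ) : ℕ := botIdeal (DeltaK k ℓ lam)

/-- A removable root of a root ideal. -/
def IsRemovable (ℓ : ℕ) (Ψ : Finset (ℕ × ℕ)) (α : ℕ × ℕ) : Prop :=
  α ∈ Ψ ∧ IsRootIdeal ℓ (Ψ.erase α)

/-- `down_Ψ(x)` is defined, i.e. row `x` of `Ψ` contains a removable root. -/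
def HasDown (ℓ : ℕ) (Ψ : Finset (ℕ × ℕ)) (x : ℕ) : Prop :=
  ∃ j, IsRemovable ℓ Ψ (x, j)

/-- `down_Ψ(x)`: the column of the removable root in row `x` (junk value `0` if
row `x` has no removable root). -/
def down (ℓ : ℕ) (Ψ : Finset (ℕ × ℕ)) (x : ℕ) : ℕ :=
  ((Ψ.filter fun p => p.1 = x ∧ IsRemovable ℓ Ψ p).image Prod.snd).sup id

/-- `down_λ := down_{Δ^k(λ)}`. -/
def downL (k ℓ : ℕ) (lam : ℕ → ℤ) : ℕ → ℕ := down ℓ (DeltaK k ℓ lam)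

/-- The `a`-fold iterate `down_Ψ^a(x)` is defined. -/
def DownIterDefined (ℓ : ℕ) (Ψ : Finset (ℕ × ℕ)) (a x : ℕ) : Prop :=
  ∀ b < a, HasDown ℓ Ψ ((down ℓ Ψ)^[b] x)

/-- `L(ℛ)`: the multiset of second components of `ℛ`, with multiplicity. -/
def Lmul (ℛ : Finset (ℕ × ℕ)) : Multiset ℕ := ℛ.val.map Prod.snd

/-- `λ ∈ P_ℓ^k`: a `k`-bounded partition with `ℓ` parts allowed to be zero. -/
def IsKBounded (k ℓ : ℕ) (lam : ℕ → ℤ) : Prop :=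
  lam 1 ≤ (k : ℤ) ∧ (∀ i, 1 ≤ i → i < ℓ → lam (i + 1) ≤ lam i) ∧ 0 ≤ lam ℓ

/-- The multiset `M_z(λ)`: `L(Δ^k(λ))` with one occurrence of `down_λ(x)` removed
for each `x ∈ [z, bot_λ]`. -/
def Mz (k ℓ : ℕ) (lam : ℕ → ℤ) (z : ℕ) : Multiset ℕ :=
  Lmul (DeltaK k ℓ lam) - ((Finset.Icc z (botL k ℓ lam)).val.map (downL k ℓ lam))

/-- The `K`-`k`-Schur function of weight `z`: `ĝ_λ^{(z)} = K(Δ^k(λ); M_z(λ); λ)`. -/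
def wkschur (k ℓ : ℕ) (lam : ℕ → ℤ) (z : ℕ) : R :=
  katalan ℓ (DeltaK k ℓ lam) (Mz k ℓ lam z) lam

/-- The `K`-`k`-Schur function `g_λ^{(k)} = K(Δ^k(λ); L(Δ^{k+1}(λ)); λ)`. -/
def kkschur (k ℓ : ℕ) (lam : ℕ → ℤ) : R :=
  katalan ℓ (DeltaK k ℓ lam) (Lmul (DeltaK (k + 1) ℓ lam)) lam

/-- The closed `k`-Schur Katalan function `𝔤_λ^{(k)} = K(Δ^k(λ); L(Δ^k(λ)); λ)`. -/
def closedkschur (k ℓ : ℕ) (lam : ℕ → ℤ) : R :=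
  katalan ℓ (DeltaK k ℓ lam) (Lmul (DeltaK k ℓ lam)) lam

/-- `|λ| = λ_1 + ⋯ + λ_ℓ`. -/
def psize (ℓ : ℕ) (lam : ℕ → ℤ) : ℤ := ∑ i ∈ Finset.Icc 1 ℓ, lam i

/-! ### The functions `h_m`, `k_m^{(r)}` and `g_γ` -/

theorem hh_of_neg {m : ℤ} (hm : m < 0) : hh m = 0 := by
  funext d
  have h0 : (0 : ℤ) ≤ d.sum fun _ e => (e : ℤ) := Finsupp.sum_nonneg fun _ _ => by positivity
  exact if_neg (by omega)

theorem kk_eq_sum (r : ℕ) (m : ℤ) {N : ℕ} (hN : m.toNat + 1 ≤ N) :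
    kk r m = ∑ i ∈ Finset.range N, ((r + i - 1).choose i : ℚ) • hh (m - (i : ℤ)) := by
  refine Finset.sum_subset (Finset.range_mono hN) fun i _ hi => ?_
  rw [hh_of_neg, smul_zero]
  simp only [Finset.mem_range] at hi
  omega

theorem kk_of_neg (r : ℕ) {m : ℤ} (hm : m < 0) : kk r m = 0 :=
  Finset.sum_eq_zero fun i _ => by rw [hh_of_neg (by omega), smul_zero]

theorem kk_succ_sub (r : ℕ) (m : ℤ) : kk (r + 1) m - kk (r + 1) (m - 1) = kk r m := by
  rw [kk_eq_sum (r + 1) m (N := m.toNat + 1 + 1) (by omega),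
    kk_eq_sum r m (N := m.toNat + 1 + 1) (by omega),
    kk_eq_sum (r + 1) (m - 1) (N := m.toNat + 1) (by omega),
    Finset.sum_range_succ', Finset.sum_range_succ' _ (m.toNat + 1), add_sub_right_comm,
    ← Finset.sum_sub_distrib]
  congr 1
  · refine Finset.sum_congr rfl fun i _ => ?_
    have h1 : m - 1 - (i : ℤ) = m - ((i + 1 : ℕ) : ℤ) := by push_cast; ring
    have h2 : r + 1 + (i + 1) - 1 = r + i + 1 := by omega
    have h3 : r + 1 + i - 1 = r + i := by omega
    have h4 : r + (i + 1) - 1 = r + i := by omega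
    rw [h1, h2, h3, h4, ← sub_smul, Nat.choose_succ_succ (r + i) i]
    push_cast
    congr 1
    ring
  · simp

/-- If some part of `γ` is very negative then `g_γ` vanishes. -/
theorem gg_eq_zero_of_lt {ℓ : ℕ} {γ : ℕ → ℤ} {a : ℕ} (ha : a ∈ Finset.Icc 1 ℓ)
    (h : γ a < (a : ℤ) - ℓ) : gg ℓ γ = 0 := by
  rw [Finset.mem_Icc] at ha
  obtain ⟨a, rfl⟩ : ∃ b, a = b + 1 := ⟨a - 1, by omega⟩
  refine Matrix.det_eq_zero_of_row_eq_zero (⟨a, by omega⟩ : Fin ℓ) fun j => ?_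
  have := j.2
  simp only [Matrix.of_apply]
  exact kk_of_neg _ (by push_cast at h; omega)

/-- Reflection of a weight in positions `y` and `y + 1`. -/
def mirror (y : ℕ) (γ : ℕ → ℤ) : ℕ → ℤ := fun x =>
  if x = y then γ (y + 1) - 1 else if x = y + 1 then γ y + 1 else γ x

theorem gg_sub_gg_eq_det {ℓ : ℕ} (γ : ℕ → ℤ) {y : ℕ} (hy : 1 ≤ y) (hyl : y < ℓ) :
    gg ℓ γ - gg ℓ (γ - eps (y + 1)) =
      (Matrix.of fun i j : Fin ℓ =>
        kk (if i.val = y then y - 1 else i.val)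
          (γ (i.val + 1) + (j.val : ℤ) - (i.val : ℤ))).det := by
  set A : Matrix (Fin ℓ) (Fin ℓ) R := Matrix.of fun i j : Fin ℓ =>
    kk i.val ((γ - eps (y + 1)) (i.val + 1) + (j.val : ℤ) - (i.val : ℤ)) with hA
  set B : Matrix (Fin ℓ) (Fin ℓ) R := Matrix.of fun i j : Fin ℓ =>
    kk (if i.val = y then y - 1 else i.val)
      (γ (i.val + 1) + (j.val : ℤ) - (i.val : ℤ)) with hB
  have hsplit : (Matrix.of fun i j : Fin ℓ =>
      kk i.val (γ (i.val + 1) + (j.val : ℤ) - (i.val : ℤ))) =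
        Matrix.updateRow A ⟨y, hyl⟩ (A ⟨y, hyl⟩ + B ⟨y, hyl⟩) := by
    ext i j : 1
    rcases eq_or_ne i ⟨y, hyl⟩ with rfl | hi
    · obtain ⟨w, rfl⟩ : ∃ w, y = w + 1 := ⟨y - 1, by omega⟩
      simp only [Matrix.updateRow_self, Pi.add_apply, hA, hB, Matrix.of_apply, eps, Pi.sub_apply,
        if_true, Nat.add_sub_cancel]
      rw [← kk_succ_sub w]
      have harg (a b c : ℤ) : a - 1 + b - c = a + b - c - 1 := by ring
      rw [harg, add_sub_cancel]
    · have hne : i.val ≠ y := fun h => hi (Fin.ext h)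
      simp [Matrix.updateRow_ne hi, hA, eps, hne]
  have hBA : Matrix.updateRow A ⟨y, hyl⟩ (B ⟨y, hyl⟩) = B := by
    ext i j : 1
    rcases eq_or_ne i ⟨y, hyl⟩ with rfl | hi
    · rw [Matrix.updateRow_self]
    · have hne : i.val ≠ y := fun h => hi (Fin.ext h)
      simp [Matrix.updateRow_ne hi, hA, hB, eps, hne]
  have hg : gg ℓ γ = A.det + B.det := by
    unfold gg
    rw [hsplit, Matrix.det_updateRow_add, hBA, Matrix.updateRow_eq_self]
  rw [hg]
  exact add_sub_cancel_left _ _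

/-- `(1 - L_{y+1}) g_γ` is antisymmetric under reflection in positions `y` and `y + 1`. -/
theorem gg_sub_gg_mirror {ℓ : ℕ} (γ : ℕ → ℤ) {y : ℕ} (hy : 1 ≤ y) (hyl : y < ℓ) :
    gg ℓ (mirror y γ) - gg ℓ (mirror y γ - eps (y + 1)) =
      -(gg ℓ γ - gg ℓ (γ - eps (y + 1))) := by
  rw [gg_sub_gg_eq_det _ hy hyl, gg_sub_gg_eq_det _ hy hyl]
  have hne : (⟨y - 1, by omega⟩ : Fin ℓ) ≠ ⟨y, hyl⟩ := by
    intro h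
    have := congrArg Fin.val h
    simp only at this
    omega
  set B : Matrix (Fin ℓ) (Fin ℓ) R := Matrix.of fun i j : Fin ℓ =>
    kk (if i.val = y then y - 1 else i.val)
      (γ (i.val + 1) + (j.val : ℤ) - (i.val : ℤ)) with hB
  have hdet := Matrix.det_permute (Equiv.swap (⟨y - 1, by omega⟩ : Fin ℓ) ⟨y, hyl⟩) B
  rw [Equiv.Perm.sign_swap hne] at hdet
  simp only [Units.val_neg, Units.val_one, Int.cast_neg, Int.cast_one, neg_mul, one_mul] at hdet
  rw [← hdet]
  congr 1
  ext i j : 1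
  simp only [Matrix.submatrix_apply, id, hB, Matrix.of_apply, mirror]
  rcases eq_or_ne i ⟨y, hyl⟩ with rfl | hi
  · have h1 : y - 1 ≠ y := by omega
    have h2 : y - 1 + 1 = y := by omega
    have h3 : ((y - 1 : ℕ) : ℤ) = y - 1 := by omega
    simp only [Equiv.swap_apply_right, if_true, if_neg h1, h2, h3, Nat.succ_ne_self, if_false]
    congr 1
    ring
  · rcases eq_or_ne i ⟨y - 1, by omega⟩ with rfl | hi'
    · have h1 : y - 1 ≠ y := by omega
      have h2 : y - 1 + 1 = y := by omega
      have h3 : ((y - 1 : ℕ) : ℤ) = y - 1 := by omega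
      simp only [Equiv.swap_apply_left, if_true, if_neg h1, h2, h3]
      congr 1
      ring
    · have h1 : i.val ≠ y := fun h => hi (Fin.ext h)
      have h2 : i.val + 1 ≠ y := fun h => hi' (Fin.ext (by simp only; omega))
      have h3 : i.val + 1 ≠ y + 1 := by omega
      rw [Equiv.swap_apply_of_ne_of_ne hi' hi, if_neg h1, if_neg h2, if_neg h3]

/-! ### Summation over root multiplicities and lowering operators -/

/-- The root `ε_i - ε_j` attached to the pair `(i, j)`. -/
def rootVec (p : ℕ × ℕ) : ℕ → ℤ := eps p.1 - eps p.2

/-- The weight `∑_{p ∈ Ψ} α_p (ε_i - ε_j)`. -/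
def rootWt (Ψ : Finset (ℕ × ℕ)) (α : ℕ × ℕ →₀ ℕ) : ℕ → ℤ :=
  ∑ p ∈ Ψ, (α p : ℤ) • rootVec p

/-- Root multiplicities supported on `Ψ`. -/
def rootMults (Ψ : Finset (ℕ × ℕ)) : Set (ℕ × ℕ →₀ ℕ) := {α | α.support ⊆ Ψ}

/-- The operator `∏_{(i,j) ∈ Ψ} (1 - R_{ij})^{-1}`. -/
def rootSum (Ψ : Finset (ℕ × ℕ)) (f : (ℕ → ℤ) → R) (γ : ℕ → ℤ) : R :=
  ∑ᶠ α ∈ rootMults Ψ, f (γ + rootWt Ψ α)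

/-- The operator `∏_{z ∈ M} (1 - L_z)`. -/
def lowered (M : Multiset ℕ) (f : (ℕ → ℤ) → R) (γ : ℕ → ℤ) : R :=
  (M.powerset.map fun S =>
    (-1 : R) ^ Multiset.card S * f (γ - fun x => (S.map fun z => eps z x).sum)).sum

theorem mem_rootMults {Ψ : Finset (ℕ × ℕ)} {α : ℕ × ℕ →₀ ℕ} :
    α ∈ rootMults Ψ ↔ ∀ p, p ∉ Ψ → α p = 0 := by
  simp only [rootMults, Set.mem_ofPred_eq, Finset.subset_iff, Finsupp.mem_support_iff]
  exact forall_congr' fun p => not_imp_comm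

theorem katalan_eq_lowered (ℓ : ℕ) (Ψ : Finset (ℕ × ℕ)) (M : Multiset ℕ) (γ : ℕ → ℤ) :
    katalan ℓ Ψ M γ = lowered M (rootSum Ψ (gg ℓ)) γ := by
  unfold katalan lowered rootSum
  refine congrArg Multiset.sum (Multiset.map_congr rfl fun S _ => ?_)
  congr 1
  rw [← finsum_mem_univ]
  symm
  refine finsum_mem_eq_of_bijOn (fun α (p : {p // p ∈ Ψ}) => α p.1) ⟨?_, ?_, ?_⟩ ?_
  · exact fun _ _ => Set.mem_univ _
  · intro α hα β hβ hab
    ext p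
    by_cases hp : p ∈ Ψ
    · exact congrFun hab ⟨p, hp⟩
    · rw [mem_rootMults.1 hα p hp, mem_rootMults.1 hβ p hp]
  · intro a _
    refine ⟨Finsupp.indicator Ψ fun p hp => a ⟨p, hp⟩, Finsupp.support_indicator_subset _ _, ?_⟩
    funext p
    simp
  · intro α _
    congr 1
    funext x
    have hsum : (∑ p ∈ Ψ.attach, ((α p.1 : ℕ) : ℤ) * (eps p.1.1 x - eps p.1.2 x)) =
        rootWt Ψ α x := by
      rw [rootWt, Finset.sum_apply, ← Finset.sum_attach Ψ]
      simp [rootVec]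
    rw [hsum]
    simp only [Pi.add_apply, Pi.sub_apply]
    ring

/-- A height function that strictly decreases along positive roots. -/
def height (ℓ : ℕ) (γ : ℕ → ℤ) : ℤ := ∑ a ∈ Finset.Icc 1 ℓ, (a : ℤ) * γ a

theorem height_add (ℓ : ℕ) (γ δ : ℕ → ℤ) : height ℓ (γ + δ) = height ℓ γ + height ℓ δ := by
  simp [height, mul_add, Finset.sum_add_distrib]

theorem height_sum_smul (ℓ : ℕ) (s : Finset (ℕ × ℕ)) (c : ℕ × ℕ → ℤ) (v : ℕ × ℕ → ℕ → ℤ) :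
    height ℓ (∑ p ∈ s, c p • v p) = ∑ p ∈ s, c p * height ℓ (v p) := by
  simp only [height, Finset.sum_apply, Pi.smul_apply, smul_eq_mul, Finset.mul_sum]
  rw [Finset.sum_comm]
  exact Finset.sum_congr rfl fun _ _ => Finset.sum_congr rfl fun _ _ => by ring

theorem height_rootVec {ℓ : ℕ} {p : ℕ × ℕ} (hp : p ∈ DeltaPlus ℓ) :
    height ℓ (rootVec p) ≤ -1 := by
  simp only [DeltaPlus, Finset.mem_filter, Finset.mem_product, Finset.mem_Icc] at hp
  have h1 : p.1 ∈ Finset.Icc 1 ℓ := by simp; omega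
  have h2 : p.2 ∈ Finset.Icc 1 ℓ := by simp; omega
  simp only [height, rootVec, eps, Pi.sub_apply, mul_sub, mul_ite, mul_one, mul_zero,
    Finset.sum_sub_distrib, Finset.sum_ite_eq', if_pos h1, if_pos h2]
  omega

/-- The support of `f` is bounded below in height. -/
def HeightBounded (ℓ : ℕ) (f : (ℕ → ℤ) → R) : Prop :=
  ∃ C : ℤ, ∀ γ, f γ ≠ 0 → C ≤ height ℓ γ

theorem heightBounded_gg (ℓ : ℕ) : HeightBounded ℓ (gg ℓ) := by
  refine ⟨∑ a ∈ Finset.Icc 1 ℓ, (a : ℤ) * ((a : ℤ) - ℓ), fun γ hγ => ?_⟩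
  refine Finset.sum_le_sum fun a ha => mul_le_mul_of_nonneg_left ?_ (by positivity)
  by_contra! h
  exact hγ (gg_eq_zero_of_lt ha h)

theorem HeightBounded.translate {ℓ : ℕ} {f : (ℕ → ℤ) → R} (hf : HeightBounded ℓ f) (v : ℕ → ℤ) :
    HeightBounded ℓ fun γ => f (γ + v) := by
  obtain ⟨C, hC⟩ := hf
  refine ⟨C - height ℓ v, fun γ hγ => ?_⟩
  have := hC _ hγ
  rw [height_add] at this
  omega

theorem HeightBounded.finite_support {ℓ : ℕ} {f : (ℕ → ℤ) → R} (hf : HeightBounded ℓ f)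
    {Ψ : Finset (ℕ × ℕ)} (hΨ : Ψ ⊆ DeltaPlus ℓ) (γ : ℕ → ℤ) :
    (rootMults Ψ ∩ Function.support fun α => f (γ + rootWt Ψ α)).Finite := by
  obtain ⟨C, hC⟩ := hf
  refine (Set.finite_Icc (0 : ℕ × ℕ →₀ ℕ)
    (Finsupp.indicator Ψ fun _ _ => (height ℓ γ - C).toNat)).subset ?_
  rintro α ⟨hα, hne⟩
  refine ⟨zero_le, fun p => ?_⟩
  by_cases hp : p ∈ Ψ
  · rw [Finsupp.indicator_of_mem hp]
    have h1 := hC _ hne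
    rw [height_add, rootWt, height_sum_smul] at h1
    have h2 : ∑ q ∈ Ψ, (α q : ℤ) * height ℓ (rootVec q) ≤ ∑ q ∈ Ψ, -(α q : ℤ) :=
      Finset.sum_le_sum fun q hq => by
        have := height_rootVec (hΨ hq)
        nlinarith [Int.natCast_nonneg (α q)]
    rw [Finset.sum_neg_distrib] at h2
    have h3 : (α p : ℤ) ≤ ∑ q ∈ Ψ, (α q : ℤ) :=
      Finset.single_le_sum (f := fun q => (α q : ℤ)) (fun _ _ => by positivity) hp
    omega
  · rw [mem_rootMults.1 hα p hp]
    exact zero_le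

theorem rootWt_erase {Ψ : Finset (ℕ × ℕ)} {p : ℕ × ℕ} {α : ℕ × ℕ →₀ ℕ} (h : α p = 0) :
    rootWt (Ψ.erase p) α = rootWt Ψ α := by
  unfold rootWt
  exact Finset.sum_erase _ (by simp [h])

theorem rootWt_add_single {Ψ : Finset (ℕ × ℕ)} {p : ℕ × ℕ} (hp : p ∈ Ψ) (α : ℕ × ℕ →₀ ℕ) :
    rootWt Ψ (α + Finsupp.single p 1) = rootVec p + rootWt Ψ α := by
  simp only [rootWt, Finsupp.add_apply, Nat.cast_add, add_smul, Finset.sum_add_distrib]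
  rw [add_comm]
  congr 1
  rw [Finset.sum_eq_single p]
  · simp
  · intro q _ hq
    simp [Finsupp.single_eq_of_ne hq]
  · exact fun h => absurd hp h

/-- Removing one root from `Ψ`. -/
theorem rootSum_eq_erase_add {ℓ : ℕ} {f : (ℕ → ℤ) → R} (hf : HeightBounded ℓ f)
    {Ψ : Finset (ℕ × ℕ)} (hΨ : Ψ ⊆ DeltaPlus ℓ) {p : ℕ × ℕ} (hp : p ∈ Ψ) (γ : ℕ → ℤ) :
    rootSum Ψ f γ = rootSum (Ψ.erase p) f γ + rootSum Ψ f (γ + rootVec p) := by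
  have hunion : rootMults Ψ =
      rootMults (Ψ.erase p) ∪ (fun α => α + Finsupp.single p 1) '' rootMults Ψ := by
    ext α
    constructor
    · intro hα
      by_cases h : α p = 0
      · refine Or.inl (mem_rootMults.2 fun q hq => ?_)
        by_cases hqp : q = p
        · rw [hqp, h]
        · exact mem_rootMults.1 hα q fun h' => hq (Finset.mem_erase.2 ⟨hqp, h'⟩)
      · refine Or.inr ⟨α - Finsupp.single p 1, mem_rootMults.2 fun q hq => ?_, ?_⟩
        · simp [mem_rootMults.1 hα q hq]
        · refine tsub_add_cancel_of_le ?_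
          rw [Finsupp.single_le_iff]
          omega
    · rintro (hα | ⟨β, hβ, rfl⟩)
      · exact mem_rootMults.2 fun q hq =>
          mem_rootMults.1 hα q fun h => hq (Finset.mem_of_mem_erase h)
      · refine mem_rootMults.2 fun q hq => ?_
        have hqp : q ≠ p := fun h => hq (h ▸ hp)
        simp [mem_rootMults.1 hβ q hq, Finsupp.single_eq_of_ne hqp]
  have herase : ∀ α ∈ rootMults (Ψ.erase p), α p = 0 := fun α hα =>
    mem_rootMults.1 hα p (Finset.notMem_erase p Ψ)
  have hdisj : Disjoint (rootMults (Ψ.erase p))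
      ((fun α => α + Finsupp.single p 1) '' rootMults Ψ) := by
    rw [Set.disjoint_left]
    rintro _ hα ⟨β, -, rfl⟩
    have := herase _ hα
    simp at this
  have hfin := hf.finite_support hΨ γ
  have h1 : rootSum (Ψ.erase p) f γ = ∑ᶠ α ∈ rootMults (Ψ.erase p), f (γ + rootWt Ψ α) :=
    finsum_mem_congr rfl fun α hα => by rw [rootWt_erase (herase α hα)]
  have h2 : rootSum Ψ f (γ + rootVec p) =
      ∑ᶠ α ∈ (fun α => α + Finsupp.single p 1) '' rootMults Ψ, f (γ + rootWt Ψ α) := by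
    rw [finsum_mem_image fun α _ β _ h => add_right_cancel h]
    exact finsum_mem_congr rfl fun α _ => by rw [rootWt_add_single hp, add_assoc]
  rw [h1, h2, rootSum]
  conv_lhs => rw [hunion]
  refine finsum_mem_union' hdisj (hfin.subset ?_) (hfin.subset ?_)
  · exact Set.inter_subset_inter_left _ (hunion ▸ Set.subset_union_left)
  · refine Set.inter_subset_inter_left _ ?_
    conv_rhs => rw [hunion]
    exact Set.subset_union_right

theorem rootSum_neg (Ψ : Finset (ℕ × ℕ)) (f : (ℕ → ℤ) → R) (γ : ℕ → ℤ) :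
    rootSum Ψ (fun δ => -f δ) γ = -rootSum Ψ f γ := by
  simp only [rootSum, finsum_neg_distrib]

theorem rootSum_sub {ℓ : ℕ} {f : (ℕ → ℤ) → R} (hf : HeightBounded ℓ f)
    {Ψ : Finset (ℕ × ℕ)} (hΨ : Ψ ⊆ DeltaPlus ℓ) (v γ : ℕ → ℤ) :
    rootSum Ψ (fun δ => f δ - f (δ - v)) γ = rootSum Ψ f γ - rootSum Ψ f (γ - v) := by
  have hv : HeightBounded ℓ fun δ => -f (δ - v) := by
    obtain ⟨C, hC⟩ := hf.translate (-v)
    exact ⟨C, fun δ hδ => hC δ (by simpa [sub_eq_add_neg] using hδ)⟩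
  have hneg : -rootSum Ψ f (γ - v) = rootSum Ψ (fun δ => -f (δ - v)) γ := by
    rw [← rootSum_neg, rootSum, rootSum]
    exact finsum_mem_congr rfl fun α _ => by rw [add_sub_right_comm]
  rw [sub_eq_add_neg, hneg, rootSum, rootSum, rootSum,
    ← finsum_mem_add_distrib' (hf.finite_support hΨ γ) (hv.finite_support hΨ γ)]
  exact finsum_mem_congr rfl fun α _ => by rw [sub_eq_add_neg]

theorem eps_swap (i a b x : ℕ) : eps i (Equiv.swap a b x) = eps (Equiv.swap a b i) x := by
  simp only [eps, Equiv.swap_apply_eq_iff]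

theorem mirror_add (y : ℕ) (γ v : ℕ → ℤ) :
    mirror y (γ + v) = mirror y γ + v ∘ Equiv.swap y (y + 1) := by
  funext x
  simp only [mirror, Pi.add_apply, Function.comp_apply]
  rcases eq_or_ne x y with rfl | h1
  · simp; ring
  · rcases eq_or_ne x (y + 1) with rfl | h2
    · simp; ring
    · simp [h1, h2, Equiv.swap_apply_of_ne_of_ne h1 h2]

theorem mirror_sub (y : ℕ) (γ v : ℕ → ℤ) :
    mirror y (γ - v) = mirror y γ - v ∘ Equiv.swap y (y + 1) := by
  rw [sub_eq_add_neg, mirror_add]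
  rfl

theorem rootSum_mirror {f : (ℕ → ℤ) → R} {y : ℕ} (hf : ∀ γ, f (mirror y γ) = -f γ)
    {Ψ : Finset (ℕ × ℕ)}
    (hΨ : ∀ i j, (Equiv.swap y (y + 1) i, Equiv.swap y (y + 1) j) ∈ Ψ ↔ (i, j) ∈ Ψ)
    (γ : ℕ → ℤ) : rootSum Ψ f (mirror y γ) = -rootSum Ψ f γ := by
  set σ : Equiv.Perm (ℕ × ℕ) :=
    Equiv.prodCongr (Equiv.swap y (y + 1)) (Equiv.swap y (y + 1)) with hσ
  have hσΨ : ∀ p, σ p ∈ Ψ ↔ p ∈ Ψ := fun p => hΨ p.1 p.2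
  have hσσ : ∀ p, σ (σ p) = p := fun p => by
    rw [hσ, Equiv.prodCongr_apply]
    ext <;> simp
  have hσs : σ.symm = σ := Equiv.ext fun p => by rw [Equiv.symm_apply_eq, hσσ]
  rw [← rootSum_neg, rootSum, rootSum]
  have happ : ∀ (α : ℕ × ℕ →₀ ℕ) p, Finsupp.equivMapDomain σ α p = α (σ p) := fun α p => by
    rw [Finsupp.equivMapDomain_apply, hσs]
  have hmaps : ∀ α ∈ rootMults Ψ, Finsupp.equivMapDomain σ α ∈ rootMults Ψ := fun α hα =>
    mem_rootMults.2 fun p hp => by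
      rw [happ]
      exact mem_rootMults.1 hα _ fun h => hp ((hσΨ p).1 h)
  have hinv : ∀ α : ℕ × ℕ →₀ ℕ, Finsupp.equivMapDomain σ (Finsupp.equivMapDomain σ α) = α :=
    fun α => by ext p; rw [happ, happ, hσσ]
  refine (finsum_mem_eq_of_bijOn (Finsupp.equivMapDomain σ) ⟨hmaps, ?_, ?_⟩ ?_).symm
  · exact fun α _ β _ h => by rw [← hinv α, h, hinv]
  · exact fun α hα => ⟨_, hmaps α hα, hinv α⟩
  · intro α _
    rw [← hf, mirror_add]
    congr 2
    unfold rootWt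
    funext x
    simp only [Function.comp_apply, Finset.sum_apply, Pi.smul_apply]
    refine Finset.sum_equiv σ (fun p => (hσΨ p).symm) fun p _ => ?_
    rw [happ, hσσ]
    simp [rootVec, eps_swap, hσ]

theorem powerset_map_multiset {α β : Type*} (f : α → β) (M : Multiset α) :
    (M.map f).powerset = M.powerset.map (Multiset.map f) := by
  induction M using Multiset.induction_on with
  | empty => simp
  | cons a M ih => simp [Multiset.powerset_cons, ih, Multiset.map_add]

theorem lowered_mirror {f : (ℕ → ℤ) → R} {y : ℕ} (hf : ∀ γ, f (mirror y γ) = -f γ)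
    {M : Multiset ℕ} (hM : M.map (Equiv.swap y (y + 1)) = M) (γ : ℕ → ℤ) :
    lowered M f (mirror y γ) = -lowered M f γ := by
  unfold lowered
  conv_lhs => rw [← hM]
  rw [powerset_map_multiset, Multiset.map_map, ← Multiset.sum_map_neg]
  refine congrArg Multiset.sum (Multiset.map_congr rfl fun S _ => ?_)
  simp only [Function.comp_apply, Multiset.card_map, Multiset.map_map]
  rw [← mul_neg, ← hf, mirror_sub]
  congr 3
  funext x
  simp [eps_swap]

theorem lowered_cons (j : ℕ) (M : Multiset ℕ) (f : (ℕ → ℤ) → R) (γ : ℕ → ℤ) :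
    lowered (j ::ₘ M) f γ = lowered M (fun δ => f δ - f (δ - eps j)) γ := by
  unfold lowered
  rw [Multiset.powerset_cons, Multiset.map_add, Multiset.sum_add, Multiset.map_map,
    ← Multiset.sum_map_add]
  refine congrArg Multiset.sum (Multiset.map_congr rfl fun S _ => ?_)
  have harg : (γ - fun x => ((j ::ₘ S).map fun z => eps z x).sum) =
      (γ - fun x => (S.map fun z => eps z x).sum) - eps j := by
    funext x
    simp only [Pi.sub_apply, Multiset.map_cons, Multiset.sum_cons]
    ring
  simp only [Function.comp_apply, Multiset.card_cons, harg]
  ring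

theorem lowered_congr_add {f f₁ f₂ : (ℕ → ℤ) → R} {v : ℕ → ℤ}
    (h : ∀ γ, f γ = f₁ γ + f₂ (γ + v)) (M : Multiset ℕ) (γ : ℕ → ℤ) :
    lowered M f γ = lowered M f₁ γ + lowered M f₂ (γ + v) := by
  unfold lowered
  rw [← Multiset.sum_map_add]
  refine congrArg Multiset.sum (Multiset.map_congr rfl fun S _ => ?_)
  rw [h, mul_add, add_sub_right_comm]

/-! ### Identities for Katalan functions -/

theorem katalan_cons {ℓ : ℕ} (Ψ : Finset (ℕ × ℕ)) (M : Multiset ℕ) (j : ℕ) (γ : ℕ → ℤ) :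
    katalan ℓ Ψ (j ::ₘ M) γ = katalan ℓ Ψ M γ - katalan ℓ Ψ M (γ - eps j) := by
  simp only [katalan_eq_lowered]
  rw [lowered_cons, eq_sub_iff_add_eq]
  symm
  have := lowered_congr_add (f := rootSum Ψ (gg ℓ))
    (f₁ := fun δ => rootSum Ψ (gg ℓ) δ - rootSum Ψ (gg ℓ) (δ - eps j))
    (f₂ := rootSum Ψ (gg ℓ)) (v := -eps j) (fun δ => by rw [← sub_eq_add_neg]; ring) M γ
  rwa [← sub_eq_add_neg] at this

theorem katalan_erase {ℓ : ℕ} {Ψ : Finset (ℕ × ℕ)} (hΨ : Ψ ⊆ DeltaPlus ℓ) {p : ℕ × ℕ}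
    (hp : p ∈ Ψ) (M : Multiset ℕ) (γ : ℕ → ℤ) :
    katalan ℓ Ψ M γ = katalan ℓ (Ψ.erase p) M γ + katalan ℓ Ψ M (γ + rootVec p) := by
  simp only [katalan_eq_lowered]
  exact lowered_congr_add (rootSum_eq_erase_add (heightBounded_gg ℓ) hΨ hp) M γ

theorem katalan_eq_zero_of_symmetric {ℓ : ℕ} {Ψ : Finset (ℕ × ℕ)} (hΨ : Ψ ⊆ DeltaPlus ℓ)
    {y : ℕ} (hy : 1 ≤ y) (hyl : y < ℓ)
    (hsymm : ∀ i j, (Equiv.swap y (y + 1) i, Equiv.swap y (y + 1) j) ∈ Ψ ↔ (i, j) ∈ Ψ)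
    {M : Multiset ℕ} (hM : M.count (y + 1) = M.count y + 1)
    {γ : ℕ → ℤ} (hγ : γ (y + 1) = γ y + 1) : katalan ℓ Ψ M γ = 0 := by
  obtain ⟨N, rfl⟩ := Multiset.exists_cons_of_mem
    (Multiset.count_pos.1 (by omega : 0 < M.count (y + 1)))
  rw [Multiset.count_cons_self, Multiset.count_cons_of_ne (by omega)] at hM
  have hN : N.map (Equiv.swap y (y + 1)) = N := by
    ext a
    have h := Multiset.count_map_eq_count' (Equiv.swap y (y + 1)) N
      (Equiv.injective _) (Equiv.swap y (y + 1) a)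
    rw [Equiv.swap_apply_self] at h
    rw [h]
    rcases eq_or_ne a y with rfl | h1
    · rw [Equiv.swap_apply_left]; omega
    · rcases eq_or_ne a (y + 1) with rfl | h2
      · rw [Equiv.swap_apply_right]; omega
      · rw [Equiv.swap_apply_of_ne_of_ne h1 h2]
  have hmir : mirror y γ = γ := by
    funext x
    simp only [mirror]
    split_ifs with h1 h2
    · rw [h1, hγ]; ring
    · rw [h2, hγ]
    · rfl
  have hanti : ∀ δ, rootSum Ψ (gg ℓ) (mirror y δ) - rootSum Ψ (gg ℓ) (mirror y δ - eps (y + 1)) =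
      -(rootSum Ψ (gg ℓ) δ - rootSum Ψ (gg ℓ) (δ - eps (y + 1))) := fun δ => by
    rw [← rootSum_sub (heightBounded_gg ℓ) hΨ, ← rootSum_sub (heightBounded_gg ℓ) hΨ]
    exact rootSum_mirror (fun δ => gg_sub_gg_mirror δ hy hyl) hsymm δ
  have key := lowered_mirror
    (f := fun δ => rootSum Ψ (gg ℓ) δ - rootSum Ψ (gg ℓ) (δ - eps (y + 1))) hanti hN γ
  rw [hmir] at key
  rw [katalan_eq_lowered, lowered_cons]
  exact funext fun d => self_eq_neg.1 (congrFun key d)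

theorem katalan_eq_zero_of_last_neg {ℓ : ℕ} (hℓ : 1 ≤ ℓ) {Ψ : Finset (ℕ × ℕ)}
    (hΨ : Ψ ⊆ DeltaPlus ℓ) (M : Multiset ℕ) {γ : ℕ → ℤ} (hγ : γ ℓ < 0) :
    katalan ℓ Ψ M γ = 0 := by
  rw [katalan_eq_lowered, lowered]
  refine Multiset.sum_eq_zero fun r hr => ?_
  obtain ⟨S, -, rfl⟩ := Multiset.mem_map.1 hr
  have hz : rootSum Ψ (gg ℓ) (γ - fun x => (S.map fun z => eps z x).sum) = 0 := by
    refine finsum_mem_eq_zero_of_forall_eq_zero fun α _ => ?_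
    refine gg_eq_zero_of_lt (a := ℓ) (by simp; omega) ?_
    have h1 : 0 ≤ (S.map fun z => eps z ℓ).sum := Multiset.sum_nonneg fun n hn => by
      obtain ⟨z, -, rfl⟩ := Multiset.mem_map.1 hn
      unfold eps
      split_ifs <;> norm_num
    have h2 : rootWt Ψ α ℓ ≤ 0 := by
      rw [rootWt, Finset.sum_apply]
      refine Finset.sum_nonpos fun p hp => ?_
      have hp' := hΨ hp
      simp only [DeltaPlus, Finset.mem_filter, Finset.mem_product, Finset.mem_Icc] at hp'
      have h3 : rootVec p ℓ ≤ 0 := by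
        simp only [rootVec, eps, Pi.sub_apply]
        split_ifs <;> omega
      exact mul_nonpos_of_nonneg_of_nonpos (Int.natCast_nonneg _) h3
    simp only [Pi.add_apply, Pi.sub_apply]
    omega
  rw [hz, mul_zero]

/-! ### The root ideal of a `k`-bounded partition -/

theorem mem_DeltaPlus {ℓ i j : ℕ} : (i, j) ∈ DeltaPlus ℓ ↔ 1 ≤ i ∧ i < j ∧ j ≤ ℓ := by
  simp only [DeltaPlus, Finset.mem_filter, Finset.mem_product, Finset.mem_Icc]
  omega

theorem mem_DeltaK {k ℓ : ℕ} {lam : ℕ → ℤ} {i j : ℕ} :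
    (i, j) ∈ DeltaK k ℓ lam ↔ (1 ≤ i ∧ i < j ∧ j ≤ ℓ) ∧ (k : ℤ) - lam i + i < j := by
  rw [DeltaK, Finset.mem_filter, mem_DeltaPlus]

/-- The roots of `Δ^k(λ)` other than the removable ones in rows `z` and below. -/
def lowerRoots (k ℓ : ℕ) (lam : ℕ → ℤ) (z : ℕ) : Finset (ℕ × ℕ) :=
  (DeltaK k ℓ lam).filter fun p => ¬(z ≤ p.1 ∧ (p.2 : ℤ) = (k : ℤ) - lam p.1 + p.1 + 1)

theorem mem_lowerRoots {k ℓ : ℕ} {lam : ℕ → ℤ} {z i j : ℕ} :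
    (i, j) ∈ lowerRoots k ℓ lam z ↔ ((1 ≤ i ∧ i < j ∧ j ≤ ℓ) ∧ (k : ℤ) - lam i + i < j) ∧
      ¬(z ≤ i ∧ (j : ℤ) = (k : ℤ) - lam i + i + 1) := by
  rw [lowerRoots, Finset.mem_filter, mem_DeltaK]

theorem DeltaK_subset (k ℓ : ℕ) (lam : ℕ → ℤ) : DeltaK k ℓ lam ⊆ DeltaPlus ℓ :=
  Finset.filter_subset _ _

theorem IsKBounded.anti {k ℓ : ℕ} {lam : ℕ → ℤ} (h : IsKBounded k ℓ lam) {i j : ℕ}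
    (hi : 1 ≤ i) (hij : i ≤ j) (hj : j ≤ ℓ) : lam j ≤ lam i := by
  induction j, hij using Nat.le_induction with
  | base => exact le_rfl
  | succ n hn ih => exact (h.2.1 n (by omega) (by omega)).trans (ih (by omega))

theorem IsKBounded.le_k {k ℓ : ℕ} {lam : ℕ → ℤ} (h : IsKBounded k ℓ lam) {i : ℕ}
    (hi : 1 ≤ i) (hj : i ≤ ℓ) : lam i ≤ k :=
  (h.anti le_rfl hi hj).trans h.1

theorem downL_eq {k ℓ : ℕ} {lam : ℕ → ℤ} (h : IsKBounded k ℓ lam) {x j : ℕ} (hx : 1 ≤ x)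
    (hxl : x ≤ ℓ) (hj : (j : ℤ) = k - lam x + x + 1) (hjl : j ≤ ℓ) : downL k ℓ lam x = j := by
  have hxk := h.le_k hx hxl
  have hmem : (x, j) ∈ DeltaK k ℓ lam := mem_DeltaK.2 (by omega)
  have hset : ((DeltaK k ℓ lam).filter fun p => p.1 = x ∧ IsRemovable ℓ (DeltaK k ℓ lam) p) =
      {(x, j)} := by
    ext ⟨a, b⟩
    rw [Finset.mem_filter, Finset.mem_singleton]
    constructor
    · rintro ⟨hab, hax, -, hrem⟩
      obtain rfl : a = x := hax
      by_contra hne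
      have hbj : b ≠ j := fun hb => hne (by rw [hb])
      have hab' := mem_DeltaK.1 hab
      have := hrem.2 a j a b (Finset.mem_erase.2 ⟨by simp [hbj.symm], hmem⟩)
        (mem_DeltaPlus.2 hab'.1) le_rfl (by omega)
      exact Finset.notMem_erase _ _ this
    · rintro hab
      rw [hab]
      refine ⟨hmem, rfl, hmem, (Finset.erase_subset _ _).trans (DeltaK_subset _ _ _), ?_⟩
      intro a b c d hab hcd hca hbd
      rw [Finset.mem_erase, mem_DeltaK] at hab
      rw [mem_DeltaPlus] at hcd
      have hac := h.anti hcd.1 hca (by omega)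
      refine Finset.mem_erase.2 ⟨fun heq => hab.1 ?_, mem_DeltaK.2 (by omega)⟩
      obtain ⟨rfl, rfl⟩ := Prod.mk.inj heq
      rw [Prod.mk.injEq]
      omega
  rw [downL, down, hset]
  simp

theorem le_botL_iff {k ℓ : ℕ} {lam : ℕ → ℤ} (h : IsKBounded k ℓ lam) {x : ℕ} (hx : 1 ≤ x) :
    x ≤ botL k ℓ lam ↔ x ≤ ℓ ∧ (k : ℤ) - lam x + x + 1 ≤ ℓ := by
  rw [botL, botIdeal, Finset.le_sup_iff (bot_lt_iff_ne_bot.2 (by rw [Nat.bot_eq_zero]; omega))]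
  constructor
  · rintro ⟨⟨i, j⟩, hij, hxi⟩
    rw [mem_DeltaK] at hij
    simp only at hxi
    have := h.anti hx hxi (by omega)
    omega
  · rintro ⟨hxl, hd⟩
    have := h.le_k hx hxl
    exact ⟨(x, ℓ), mem_DeltaK.2 (by omega), le_rfl⟩

theorem Mz_eq {k ℓ : ℕ} {lam : ℕ → ℤ} (h : IsKBounded k ℓ lam) {z : ℕ} (hz : 1 ≤ z) :
    Mz k ℓ lam z = Lmul (lowerRoots k ℓ lam z) := by
  have hrem : ((DeltaK k ℓ lam).filter fun p =>
      z ≤ p.1 ∧ (p.2 : ℤ) = (k : ℤ) - lam p.1 + p.1 + 1) =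
        (Finset.Icc z (botL k ℓ lam)).map
          ⟨fun x => (x, downL k ℓ lam x), fun _ _ hab => (Prod.mk.inj hab).1⟩ := by
    ext ⟨i, j⟩
    simp only [Finset.mem_filter, mem_DeltaK, Finset.mem_map, Finset.mem_Icc]
    constructor
    · rintro ⟨⟨hij, -⟩, hzi, hj⟩
      exact ⟨i, ⟨hzi, (le_botL_iff h hij.1).2 (by omega)⟩,
        Prod.ext rfl (downL_eq h hij.1 (by omega) hj hij.2.2)⟩
    · rintro ⟨x, ⟨hzx, hxb⟩, heq⟩
      obtain ⟨rfl, rfl⟩ := Prod.mk.inj heq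
      obtain ⟨hxl, hd⟩ := (le_botL_iff h (hz.trans hzx)).1 hxb
      have hxk := h.le_k (hz.trans hzx) hxl
      have hdown := downL_eq h (j := ((k : ℤ) - lam x + x + 1).toNat) (hz.trans hzx) hxl
        (by omega) (by omega)
      omega
  have hsplit : Lmul (DeltaK k ℓ lam) = Lmul (lowerRoots k ℓ lam z) +
      (Finset.Icc z (botL k ℓ lam)).val.map (downL k ℓ lam) := by
    have hmap : (Finset.Icc z (botL k ℓ lam)).val.map (downL k ℓ lam) =
        Lmul ((DeltaK k ℓ lam).filter fun p =>
          z ≤ p.1 ∧ (p.2 : ℤ) = (k : ℤ) - lam p.1 + p.1 + 1) := by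
      rw [hrem, Lmul, Finset.map_val, Multiset.map_map]
      rfl
    rw [hmap, Lmul, Lmul, Lmul, lowerRoots, Finset.filter_val, Finset.filter_val,
      ← Multiset.map_add, add_comm, Multiset.filter_add_not]
  rw [Mz, hsplit, Multiset.add_sub_cancel_right]

theorem wkschur_eq {k ℓ : ℕ} {lam : ℕ → ℤ} (h : IsKBounded k ℓ lam) {z : ℕ} (hz : 1 ≤ z) :
    wkschur k ℓ lam z = katalan ℓ (DeltaK k ℓ lam) (Lmul (lowerRoots k ℓ lam z)) lam := by
  rw [wkschur, Mz_eq h hz]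

theorem Lmul_insert {A : Finset (ℕ × ℕ)} {p : ℕ × ℕ} (hp : p ∉ A) :
    Lmul (insert p A) = p.2 ::ₘ Lmul A := by
  rw [Lmul, Finset.insert_val_of_notMem hp, Multiset.map_cons, Lmul]

theorem count_Lmul {A : Finset (ℕ × ℕ)} {j n : ℕ} (h : ∀ i, (i, j) ∈ A ↔ i ∈ Finset.Icc 1 n) :
    (Lmul A).count j = n := by
  have himage : A.filter (fun p => j = p.2) = (Finset.Icc 1 n).image fun i => (i, j) := by
    ext ⟨a, b⟩
    simp only [Finset.mem_filter, Finset.mem_image, Prod.mk.injEq]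
    constructor
    · rintro ⟨hab, rfl⟩
      exact ⟨a, (h a).1 hab, rfl, rfl⟩
    · rintro ⟨i, hi, rfl, rfl⟩
      exact ⟨(h i).2 hi, rfl⟩
  rw [Lmul, Multiset.count_map, ← Finset.filter_val, himage, Finset.card_val,
    Finset.card_image_of_injective _ fun _ _ hab => (Prod.mk.inj hab).1]
  simp

theorem count_lowerRoots_succ {k ℓ : ℕ} {lam : ℕ → ℤ} (h : IsKBounded k ℓ lam) {z x y : ℕ}
    (hz : 1 ≤ z) (hzx : z ≤ x) (hxl : x ≤ ℓ) (hy : (y : ℤ) = k - lam x + x + 1) (hyl : y < ℓ) :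
    (Lmul (lowerRoots k ℓ lam z)).count (y + 1) = (Lmul (lowerRoots k ℓ lam z)).count y + 1 := by
  have hxk := h.le_k (hz.trans hzx) hxl
  have h1 : (Lmul (lowerRoots k ℓ lam z)).count y = x - 1 := by
    refine count_Lmul fun i => ?_
    rw [mem_lowerRoots, Finset.mem_Icc]
    rcases lt_or_ge i x with hi | hi
    · rcases Nat.eq_zero_or_pos i with rfl | hi0
      · omega
      · have := h.anti hi0 hi.le hxl
        omega
    · rcases le_or_gt i ℓ with hil | hil
      · have := h.anti (hz.trans hzx) hi hil
        omega
      · omega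
  have h2 : (Lmul (lowerRoots k ℓ lam z)).count (y + 1) = x := by
    refine count_Lmul fun i => ?_
    rw [mem_lowerRoots, Finset.mem_Icc]
    push_cast
    rcases le_or_gt i x with hi | hi
    · rcases Nat.eq_zero_or_pos i with rfl | hi0
      · omega
      · have := h.anti hi0 hi hxl
        rcases eq_or_ne i x with rfl | hne
        · omega
        · omega
    · rcases le_or_gt i ℓ with hil | hil
      · have := h.anti (hz.trans hzx) hi.le hil
        omega
      · omega
  omega

/-! ### Vanishing along mirrored paths -/

theorem swap_mem_iff {ℓ : ℕ} {Ψ : Finset (ℕ × ℕ)} (hΨ : Ψ ⊆ DeltaPlus ℓ) {y : ℕ}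
    (hrow : ∀ j, (y, j) ∈ Ψ ↔ (y + 1, j) ∈ Ψ) (hcol : ∀ i < y, (i, y) ∈ Ψ ↔ (i, y + 1) ∈ Ψ)
    (i j : ℕ) : (Equiv.swap y (y + 1) i, Equiv.swap y (y + 1) j) ∈ Ψ ↔ (i, j) ∈ Ψ := by
  have hmp : ∀ i j, (i, j) ∈ Ψ → (Equiv.swap y (y + 1) i, Equiv.swap y (y + 1) j) ∈ Ψ := by
    intro i j hij
    have hlt := (mem_DeltaPlus.1 (hΨ hij)).2.1
    rcases eq_or_ne i y with rfl | hi
    · have h' := (mem_DeltaPlus.1 (hΨ ((hrow j).1 hij))).2.1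
      rw [Equiv.swap_apply_left, Equiv.swap_apply_of_ne_of_ne (by omega) (by omega)]
      exact (hrow j).1 hij
    · rcases eq_or_ne i (y + 1) with rfl | hi'
      · rw [Equiv.swap_apply_right, Equiv.swap_apply_of_ne_of_ne (by omega) (by omega)]
        exact (hrow j).2 hij
      · rw [Equiv.swap_apply_of_ne_of_ne hi hi']
        rcases eq_or_ne j y with rfl | hj
        · rw [Equiv.swap_apply_left]
          exact (hcol i hlt).1 hij
        · rcases eq_or_ne j (y + 1) with rfl | hj'
          · rw [Equiv.swap_apply_right]
            exact (hcol i (by omega)).2 hij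
          · rwa [Equiv.swap_apply_of_ne_of_ne hj hj']
  refine ⟨fun h => ?_, hmp i j⟩
  simpa only [Equiv.swap_apply_self] using hmp _ _ h

/-- The indices `z, down_λ(z), down_λ²(z), …`. -/
inductive OnPath (k ℓ : ℕ) (lam : ℕ → ℤ) (z : ℕ) : ℕ → Prop
  | start : OnPath k ℓ lam z z
  | step {x y : ℕ} : OnPath k ℓ lam z x → (y : ℤ) = k - lam x + x + 1 → y ≤ ℓ →
      OnPath k ℓ lam z y

/-- Rows `z` and `z + 1` of `Δ^k(λ)` do not end in adjacent removable roots. -/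
def StrictAt (k ℓ : ℕ) (lam : ℕ → ℤ) (z : ℕ) : Prop :=
  lam (z + 1) < lam z ∨ (ℓ : ℤ) < k - lam (z + 1) + (z + 1) + 1

theorem OnPath.bounds {k ℓ : ℕ} {lam : ℕ → ℤ} (h : IsKBounded k ℓ lam) {z : ℕ} (hz : 1 ≤ z)
    (hzl : z ≤ ℓ) {x : ℕ} (hx : OnPath k ℓ lam z x) : z ≤ x ∧ x ≤ ℓ := by
  induction hx with
  | start => exact ⟨le_rfl, hzl⟩
  | step _ hy hyl ih =>
    have := h.le_k (hz.trans ih.1) ih.2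
    omega

theorem OnPath.congr {k ℓ : ℕ} {lam μ : ℕ → ℤ} (h : IsKBounded k ℓ lam) {z : ℕ} (hz : 1 ≤ z)
    (hzl : z ≤ ℓ) {n : ℕ} (hμ : ∀ i < n, μ i = lam i) {x : ℕ} (hx : OnPath k ℓ lam z x)
    (hxn : x ≤ n) : OnPath k ℓ μ z x := by
  induction hx with
  | start => exact .start
  | step hw hy hyl ih =>
    have hb := hw.bounds h hz hzl
    have := h.le_k (hz.trans hb.1) hb.2
    exact .step (ih (by omega)) (by rw [hμ _ (by omega)]; exact hy) hyl

theorem lt_k_of_strictAt {k ℓ : ℕ} {lam : ℕ → ℤ} (h : IsKBounded k ℓ lam) {z : ℕ} (hz : 1 ≤ z)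
    (hst : StrictAt k ℓ lam z) {x : ℕ} (hzx : z < x) (hxl : x ≤ ℓ)
    (hd : (k : ℤ) - lam x + x + 1 ≤ ℓ) : lam x < k := by
  have h1 := h.anti (i := z + 1) (by omega) hzx hxl
  have h2 := h.le_k hz (hzx.le.trans hxl)
  rcases hst with h3 | h3 <;> omega

/-- If rows `y` and `y + 1` of `Ψ` agree, where `y` is on the path below `z`, and `Ψ` agrees with
`Δ^k(λ)` above row `y`, then the Katalan function vanishes at weights with
`γ_{y+1} = γ_y + 1`. -/
theorem katalan_eq_zero_of_path {k ℓ : ℕ} {lam : ℕ → ℤ} (h : IsKBounded k ℓ lam) {z : ℕ}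
    (hz : 1 ≤ z) (hzl : z ≤ ℓ) (hst : StrictAt k ℓ lam z) {x : ℕ} (hx : OnPath k ℓ lam z x)
    {y : ℕ} (hy : (y : ℤ) = k - lam x + x + 1) (hyl : y < ℓ) {Ψ : Finset (ℕ × ℕ)}
    (hΨ : Ψ ⊆ DeltaPlus ℓ) (habove : ∀ i j, i < y → ((i, j) ∈ Ψ ↔ (i, j) ∈ DeltaK k ℓ lam))
    (hrow : ∀ j, (y, j) ∈ Ψ ↔ (y + 1, j) ∈ Ψ) {γ : ℕ → ℤ} (hγ : ∀ i < y, γ i = lam i)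
    (hγy : γ (y + 1) = γ y + 1) :
    katalan ℓ Ψ (Lmul (lowerRoots k ℓ lam z)) γ = 0 := by
  induction hx generalizing y Ψ γ with
  | start =>
    have hzk := h.le_k hz hzl
    refine katalan_eq_zero_of_symmetric hΨ (by omega) hyl (swap_mem_iff hΨ hrow ?_)
      (count_lowerRoots_succ h hz le_rfl hzl hy hyl) hγy
    intro i hi
    rw [habove _ _ hi, habove _ _ hi, mem_DeltaK, mem_DeltaK]
    push_cast
    rcases le_or_gt i z with hiz | hiz
    · rcases Nat.eq_zero_or_pos i with rfl | hi0
      · omega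
      · have := h.anti hi0 hiz hzl
        omega
    · have := h.anti (i := z + 1) (by omega) hiz (by omega)
      rcases hst with h3 | h3 <;> omega
  | @step w x hw hwx hxl ih =>
    have hb := hw.bounds h hz hzl
    have hwk := h.le_k (hz.trans hb.1) hb.2
    have hxk := h.le_k (i := x) (by omega) hxl
    have hcount := count_lowerRoots_succ h hz (by omega : z ≤ x) hxl hy hyl
    have hmono := h.2.1 x (by omega) (by omega)
    rcases hmono.lt_or_eq with hlt | heq
    · refine katalan_eq_zero_of_symmetric hΨ (by omega) hyl (swap_mem_iff hΨ hrow ?_) hcount hγy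
      intro i hi
      rw [habove _ _ hi, habove _ _ hi, mem_DeltaK, mem_DeltaK]
      push_cast
      rcases le_or_gt i x with hix | hix
      · rcases Nat.eq_zero_or_pos i with rfl | hi0
        · omega
        · have := h.anti hi0 hix hxl
          omega
      · have := h.anti (i := x + 1) (by omega) hix (by omega)
        omega
    · have hxk' := lt_k_of_strictAt h hz hst (x := x) (by omega) hxl (by omega)
      have hx1y : x + 1 < y := by omega
      have hnot : (x + 1, y) ∉ Ψ := by
        rw [habove _ _ hx1y, mem_DeltaK]
        omega
      have hΨ' : insert (x + 1, y) Ψ ⊆ DeltaPlus ℓ :=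
        Finset.insert_subset (mem_DeltaPlus.2 (by omega)) hΨ
      have hexp := katalan_erase hΨ' (Finset.mem_insert_self _ _)
        (Lmul (lowerRoots k ℓ lam z)) γ
      rw [Finset.erase_insert hnot] at hexp
      have hfirst : katalan ℓ (insert (x + 1, y) Ψ) (Lmul (lowerRoots k ℓ lam z)) γ = 0 := by
        refine katalan_eq_zero_of_symmetric hΨ' (by omega) hyl (swap_mem_iff hΨ' ?_ ?_) hcount hγy
        · intro j
          rw [Finset.mem_insert, Finset.mem_insert, hrow j, Prod.mk.injEq, Prod.mk.injEq,
            or_iff_right fun hi' => by omega, or_iff_right fun hi' => by omega]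
        · intro i hi
          simp only [Finset.mem_insert, Prod.mk.injEq, habove _ _ hi, mem_DeltaK, and_true]
          rcases le_or_gt i x with hix | hix
          · rcases Nat.eq_zero_or_pos i with rfl | hi0
            · omega
            · have := h.anti hi0 hix hxl
              omega
          · rcases eq_or_ne i (x + 1) with rfl | hne
            · omega
            · have := h.anti (i := x + 1) (by omega) hix (by omega)
              omega
      have hsecond : katalan ℓ (insert (x + 1, y) Ψ) (Lmul (lowerRoots k ℓ lam z))
          (γ + rootVec (x + 1, y)) = 0 := by
        refine ih hwx (by omega) hΨ' ?_ ?_ ?_ ?_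
        · intro i j hi
          rw [Finset.mem_insert, ← habove i j (by omega), Prod.mk.injEq]
          exact or_iff_right fun hi' => by omega
        · intro j
          simp only [Finset.mem_insert, Prod.mk.injEq, habove _ _ hx1y,
            habove x _ (by omega), mem_DeltaK, true_and]
          omega
        · intro i hi
          have h1 : i ≠ x + 1 := by omega
          have h2 : i ≠ y := by omega
          simp [rootVec, eps, h1, h2, hγ i (by omega)]
        · have h1 : x + 1 ≠ y := by omega
          have h2 : x ≠ y := by omega
          simp [rootVec, eps, h1, h2, hγ x (by omega), hγ (x + 1) hx1y, heq]
      rw [hfirst, hsecond, add_zero] at hexp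
      exact hexp.symm


/-! ### The alternating cone of weight `z` functions -/

/-- The cone generated by the `(-1)^{n - |μ|} ĝ_μ^{(z)}` with `μ` agreeing with `ρ` on `[z]`. -/
def altCone (k ℓ : ℕ) (ρ : ℕ → ℤ) (z : ℕ) (n : ℤ) : AddSubmonoid R :=
  AddSubmonoid.closure {r | ∃ μ, IsKBounded k ℓ μ ∧ (∀ x ∈ Finset.Icc 1 z, μ x = ρ x) ∧
    r = ((n - psize ℓ μ).negOnePow : ℤ) • wkschur k ℓ μ z}

theorem wkschur_mem_altCone {k ℓ : ℕ} {ρ μ : ℕ → ℤ} {z : ℕ} (hμ : IsKBounded k ℓ μ)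
    (hρ : ∀ x ∈ Finset.Icc 1 z, μ x = ρ x) : wkschur k ℓ μ z ∈ altCone k ℓ ρ z (psize ℓ μ) :=
  AddSubmonoid.subset_closure ⟨μ, hμ, hρ, by simp⟩

theorem neg_mem_altCone {k ℓ : ℕ} {ρ : ℕ → ℤ} {z : ℕ} {n : ℤ} {r : R}
    (hr : r ∈ altCone k ℓ ρ z (n - 1)) : -r ∈ altCone k ℓ ρ z n := by
  induction hr using AddSubmonoid.closure_induction with
  | mem r hr =>
    obtain ⟨μ, hμ, hρ, rfl⟩ := hr
    refine AddSubmonoid.subset_closure ⟨μ, hμ, hρ, ?_⟩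
    rw [show n - psize ℓ μ = n - 1 - psize ℓ μ + 1 by ring, Int.negOnePow_succ, Units.val_neg,
      neg_smul]
  | zero => simp
  | add r s _ _ hr hs => rw [neg_add]; exact add_mem hr hs

theorem psize_sub_eps {ℓ y : ℕ} (hy : 1 ≤ y) (hyl : y ≤ ℓ) (lam : ℕ → ℤ) :
    psize ℓ (lam - eps y) = psize ℓ lam - 1 := by
  simp [psize, eps, hy, hyl]

/-- Lowering a part of `λ` below the path keeps the Katalan function in the alternating cone. -/
theorem katalan_sub_eps_mem_altCone {k ℓ : ℕ} {ρ : ℕ → ℤ} {z : ℕ} (hz : 1 ≤ z) (hzl : z ≤ ℓ)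
    {lam : ℕ → ℤ} (h : IsKBounded k ℓ lam) (hρ : ∀ x ∈ Finset.Icc 1 z, lam x = ρ x)
    (hst : StrictAt k ℓ lam z) {x y : ℕ} (hx : OnPath k ℓ lam z x)
    (hy : (y : ℤ) = k - lam x + x + 1) (hyl : y ≤ ℓ) :
    katalan ℓ (DeltaK k ℓ lam) (Lmul (lowerRoots k ℓ lam z)) (lam - eps y) ∈
      altCone k ℓ ρ z (psize ℓ lam - 1) := by
  induction hn : ℓ - y using Nat.strong_induction_on generalizing lam x y with
  | _ n ih =>
  have hxb := hx.bounds h hz hzl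
  have hxk := h.le_k (hz.trans hxb.1) hxb.2
  have hyk := h.le_k (i := y) (by omega) hyl
  have hnext : ∀ t : ℕ, (t : ℤ) = k - lam y + y + 1 → t ≤ ℓ →
      katalan ℓ (DeltaK k ℓ lam) (Lmul (lowerRoots k ℓ lam z)) (lam - eps t) ∈
        altCone k ℓ ρ z (psize ℓ lam - 1) := fun t ht htl =>
    ih _ (by omega) h hρ hst (.step hx hy hyl) ht htl rfl
  have hvec : ∀ t, lam - eps y + rootVec (y, t) = lam - eps t := fun t => by
    simp [rootVec]
  have hexp : ∀ t : ℕ, (t : ℤ) = k - lam y + y + 1 → t ≤ ℓ →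
      katalan ℓ (DeltaK k ℓ lam) (Lmul (lowerRoots k ℓ lam z)) (lam - eps y) =
        katalan ℓ ((DeltaK k ℓ lam).erase (y, t)) (Lmul (lowerRoots k ℓ lam z)) (lam - eps y) +
        katalan ℓ (DeltaK k ℓ lam) (Lmul (lowerRoots k ℓ lam z)) (lam - eps t) :=
    fun t ht htl => by
      rw [katalan_erase (DeltaK_subset _ _ _) (p := (y, t)) (mem_DeltaK.2 (by omega)), hvec]
  by_cases hcase : (y < ℓ ∧ lam (y + 1) < lam y) ∨ (y = ℓ ∧ 0 < lam ℓ)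
  · set μ := lam - eps y with hμdef
    have hμy : μ y = lam y - 1 := by simp [hμdef, eps]
    have hμne : ∀ i, i ≠ y → μ i = lam i := fun i hi => by simp [hμdef, eps, hi]
    have hμ : IsKBounded k ℓ μ := by
      refine ⟨?_, fun i hi hil => ?_, ?_⟩
      · rw [hμne 1 (by omega)]
        exact h.1
      · have := h.2.1 i hi hil
        rcases eq_or_ne i y with rfl | hi'
        · rw [hμy, hμne _ (by omega)]
          omega
        · rcases eq_or_ne (i + 1) y with hi'' | hi''
          · rw [hi'', hμy, hμne _ hi', ← hi'']
            omega
          · rwa [hμne _ hi', hμne _ hi'']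
      · have := h.2.2
        rcases eq_or_ne ℓ y with hy' | hy'
        · rw [hy', hμy, ← hy']
          omega
        · rwa [hμne _ hy']
    have hμρ : ∀ i ∈ Finset.Icc 1 z, μ i = ρ i := fun i hi => by
      rw [← hρ i hi, hμne i (by have := Finset.mem_Icc.1 hi; omega)]
    have hμsize : psize ℓ μ = psize ℓ lam - 1 := psize_sub_eps (by omega) hyl lam
    have hμst : StrictAt k ℓ μ z := by
      have h1 : μ (z + 1) ≤ lam (z + 1) := by
        rcases eq_or_ne (z + 1) y with h1 | h1
        · rw [h1, hμy]
          omega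
        · rw [hμne _ h1]
      rw [StrictAt, hμne z (by omega)]
      rcases hst with h2 | h2
      · exact Or.inl (by omega)
      · exact Or.inr (by omega)
    have hgen : katalan ℓ (DeltaK k ℓ μ) (Lmul (lowerRoots k ℓ μ z)) μ ∈
        altCone k ℓ ρ z (psize ℓ lam - 1) := by
      rw [← wkschur_eq hμ hz, ← hμsize]
      exact wkschur_mem_altCone hμ hμρ
    have hcoord : ∀ i, (i = y ∧ μ i = lam i - 1) ∨ (i ≠ y ∧ μ i = lam i) := fun i => by
      rcases eq_or_ne i y with rfl | hi
      · exact Or.inl ⟨rfl, hμy⟩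
      · exact Or.inr ⟨hi, hμne i hi⟩
    rcases lt_or_ge (ℓ : ℤ) (k - lam y + y + 1) with hd | hd
    · have hΔ : DeltaK k ℓ μ = DeltaK k ℓ lam := by
        ext ⟨i, j⟩
        rw [mem_DeltaK, mem_DeltaK]
        rcases hcoord i with ⟨rfl, hi⟩ | ⟨-, hi⟩ <;> rw [hi]
        omega
      have hL : lowerRoots k ℓ μ z = lowerRoots k ℓ lam z := by
        ext ⟨i, j⟩
        rw [mem_lowerRoots, mem_lowerRoots]
        rcases hcoord i with ⟨rfl, hi⟩ | ⟨-, hi⟩ <;> rw [hi]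
        omega
      rwa [hΔ, hL] at hgen
    · obtain ⟨t, ht⟩ : ∃ t : ℕ, (t : ℤ) = k - lam y + y + 1 :=
        ⟨((k : ℤ) - lam y + y + 1).toNat, by omega⟩
      have htl : t ≤ ℓ := by omega
      have hΔ : (DeltaK k ℓ lam).erase (y, t) = DeltaK k ℓ μ := by
        ext ⟨i, j⟩
        rw [Finset.mem_erase, mem_DeltaK, mem_DeltaK, Ne, Prod.mk.injEq]
        rcases hcoord i with ⟨rfl, hi⟩ | ⟨hne, hi⟩ <;> rw [hi] <;> omega
      rw [hexp t ht htl, hΔ]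
      refine add_mem ?_ (hnext t ht htl)
      rcases htl.lt_or_eq with htl' | rfl
      · have hL : lowerRoots k ℓ lam z = insert (y, t + 1) (lowerRoots k ℓ μ z) := by
          ext ⟨i, j⟩
          rw [Finset.mem_insert, mem_lowerRoots, mem_lowerRoots, Prod.mk.injEq]
          rcases hcoord i with ⟨rfl, hi⟩ | ⟨hne, hi⟩ <;> rw [hi] <;> omega
        have hnot : (y, t + 1) ∉ lowerRoots k ℓ μ z := by
          rw [mem_lowerRoots, hμy]
          push_cast
          omega
        rw [hL, Lmul_insert hnot, katalan_cons, sub_eq_add_neg (katalan _ _ _ _)]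
        refine add_mem hgen (neg_mem_altCone ?_)
        rw [← hμsize]
        refine ih _ (by omega) hμ hμρ hμst (x := y) (y := t + 1)
          ((OnPath.step hx hy hyl).congr h hz hzl (n := y) (fun i hi => hμne i hi.ne) le_rfl)
          (by rw [hμy]; push_cast; omega) htl' rfl
      · have hL : lowerRoots k t lam z = lowerRoots k t μ z := by
          ext ⟨i, j⟩
          rw [mem_lowerRoots, mem_lowerRoots]
          rcases hcoord i with ⟨rfl, hi⟩ | ⟨hne, hi⟩ <;> rw [hi]
          omega
        rwa [hL]
  · rcases hyl.lt_or_eq with hyl' | rfl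
    · have heq : lam (y + 1) = lam y := by
        have := h.2.1 y (by omega) hyl'
        omega
      have hγ : ∀ i < y, (lam - eps y) i = lam i := fun i hi => by simp [eps, hi.ne]
      have hγy : (lam - eps y) (y + 1) = (lam - eps y) y + 1 := by simp [eps, heq]
      rcases lt_or_ge (ℓ : ℤ) (k - lam y + y + 1) with hd | hd
      · rw [katalan_eq_zero_of_path h hz hzl hst hx hy hyl' (DeltaK_subset _ _ _)
          (fun _ _ _ => Iff.rfl) (fun j => ?_) hγ hγy]
        · exact zero_mem _
        · rw [mem_DeltaK, mem_DeltaK, heq]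
          omega
      · obtain ⟨t, ht⟩ : ∃ t : ℕ, (t : ℤ) = k - lam y + y + 1 :=
          ⟨((k : ℤ) - lam y + y + 1).toNat, by omega⟩
        have htl : t ≤ ℓ := by omega
        have hyk' := lt_k_of_strictAt h hz hst (x := y) (by omega) hyl hd
        rw [hexp t ht htl, katalan_eq_zero_of_path h hz hzl hst hx hy hyl'
          ((Finset.erase_subset _ _).trans (DeltaK_subset _ _ _)) (fun i j hi => ?_)
          (fun j => ?_) hγ hγy, zero_add]
        · exact hnext t ht htl
        · rw [Finset.mem_erase, and_iff_right (by rw [Ne, Prod.mk.injEq]; omega)]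
        · rw [Finset.mem_erase, Finset.mem_erase, mem_DeltaK, mem_DeltaK, heq, Ne, Ne,
            Prod.mk.injEq, Prod.mk.injEq]
          omega
    · have := h.2.2
      rw [katalan_eq_zero_of_last_neg (by omega) (DeltaK_subset _ _ _)]
      · exact zero_mem _
      · simp only [Pi.sub_apply, eps, if_true]
        omega

theorem wkschur_succ_mem_altCone {k ℓ : ℕ} {lam : ℕ → ℤ} (h : IsKBounded k ℓ lam) {z : ℕ}
    (hz : 1 ≤ z) (hzb : z ≤ botL k ℓ lam)
    (hstrict : z ≤ botL k ℓ lam - 1 → lam (z + 1) < lam z) :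
    wkschur k ℓ lam (z + 1) ∈ altCone k ℓ lam z (psize ℓ lam) := by
  obtain ⟨hzl, hd⟩ := (le_botL_iff h hz).1 hzb
  have hzk := h.le_k hz hzl
  have hst : StrictAt k ℓ lam z := by
    rcases le_or_gt (z + 1) (botL k ℓ lam) with hb | hb
    · exact Or.inl (hstrict (by omega))
    · have := (le_botL_iff h (x := z + 1) (by omega)).not.1 (by omega)
      push_cast at this
      exact Or.inr (by omega)
  obtain ⟨t, ht⟩ : ∃ t : ℕ, (t : ℤ) = k - lam z + z + 1 :=
    ⟨((k : ℤ) - lam z + z + 1).toNat, by omega⟩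
  have hL : lowerRoots k ℓ lam (z + 1) = insert (z, t) (lowerRoots k ℓ lam z) := by
    ext ⟨i, j⟩
    rw [Finset.mem_insert, mem_lowerRoots, mem_lowerRoots, Prod.mk.injEq]
    rcases eq_or_ne i z with rfl | hi <;> omega
  have hnot : (z, t) ∉ lowerRoots k ℓ lam z := by
    rw [mem_lowerRoots]
    omega
  rw [wkschur_eq h (by omega), hL, Lmul_insert hnot, katalan_cons, ← wkschur_eq h hz,
    sub_eq_add_neg]
  exact add_mem (wkschur_mem_altCone h fun _ _ => rfl) (neg_mem_altCone
    (katalan_sub_eps_mem_altCone hz hzl h (fun _ _ => rfl) hst .start ht (by omega)))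

/-- Membership in the alternating cone, spelled out by coefficients. -/
theorem exists_coeff_of_mem_altCone {k ℓ : ℕ} {ρ : ℕ → ℤ} {z : ℕ} {n : ℤ} {r : R}
    (hr : r ∈ altCone k ℓ ρ z n) :
    ∃ b : (ℕ → ℤ) → ℤ, (Function.support b).Finite ∧
      (∀ μ, b μ ≠ 0 → IsKBounded k ℓ μ ∧ ∀ x ∈ Finset.Icc 1 z, μ x = ρ x) ∧
      r = ∑ᶠ μ : ℕ → ℤ, b μ • wkschur k ℓ μ z ∧
      ∀ μ, 0 ≤ (-1 : ℚ) ^ (n - psize ℓ μ) * (b μ : ℚ) := by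
  induction hr using AddSubmonoid.closure_induction with
  | mem r hr =>
    obtain ⟨μ, hμ, hρ, rfl⟩ := hr
    refine ⟨Pi.single μ ((n - psize ℓ μ).negOnePow : ℤ), ?_, fun ν hν => ?_, ?_, fun ν => ?_⟩
    · exact (Set.finite_singleton μ).subset Pi.support_single_subset
    · obtain rfl : ν = μ := by
        by_contra hne
        exact hν (Pi.single_eq_of_ne hne _)
      exact ⟨hμ, hρ⟩
    · rw [finsum_eq_single _ μ fun ν hν => by rw [Pi.single_eq_of_ne hν, zero_smul],
        Pi.single_eq_same]
    · rcases eq_or_ne ν μ with rfl | hne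
      · rw [Pi.single_eq_same, Int.cast_negOnePow]
        exact mul_self_nonneg _
      · rw [Pi.single_eq_of_ne hne, Int.cast_zero, mul_zero]
  | zero => exact ⟨0, by simp, by simp, by simp, by simp⟩
  | add r s _ _ hr hs =>
    obtain ⟨b, hb, hb', rfl, hb''⟩ := hr
    obtain ⟨c, hc, hc', rfl, hc''⟩ := hs
    refine ⟨b + c, (hb.union hc).subset (Function.support_add b c), fun μ hμ => ?_, ?_,
      fun μ => ?_⟩
    · by_cases h0 : b μ = 0
      · exact hc' μ fun h1 => hμ (by simp [h0, h1])
      · exact hb' μ h0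
    · simp only [Pi.add_apply, add_smul]
      exact (finsum_add_distrib
        (hb.subset (Function.support_smul_subset_left b fun μ => wkschur k ℓ μ z))
        (hc.subset (Function.support_smul_subset_left c fun μ => wkschur k ℓ μ z))).symm
    · rw [Pi.add_apply, Int.cast_add, mul_add]
      exact add_nonneg (hb'' μ) (hc'' μ)

/-- the recursive formula expressing `ĝ_λ^{(z+1)}` alternating-positively
in terms of the `ĝ_μ^{(z)}` with `μ_x = λ_x` for `x ∈ [z]`. -/
theorem statement9 (k ℓ : ℕ) (hℓ : 1 ≤ ℓ) (lam : ℕ → ℤ) (hlam : IsKBounded k ℓ lam)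
    (z : ℕ) (hz : z ∈ Finset.Icc 1 (botL k ℓ lam))
    (hstrict : z ≤ botL k ℓ lam - 1 → lam (z + 1) < lam z) :
    ∃ b : (ℕ → ℤ) → ℤ,
      (Function.support b).Finite ∧
      (∀ μ, b μ ≠ 0 → IsKBounded k ℓ μ ∧ ∀ x ∈ Finset.Icc 1 z, μ x = lam x) ∧
      wkschur k ℓ lam (z + 1) = ∑ᶠ μ : ℕ → ℤ, b μ • wkschur k ℓ μ z ∧
      ∀ μ, IsKBounded k ℓ μ →
        0 ≤ (-1 : ℚ) ^ (psize ℓ lam - psize ℓ μ) * (b μ : ℚ) := by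
  rw [Finset.mem_Icc] at hz
  obtain ⟨b, hfin, hsupp, hsum, hsign⟩ :=
    exists_coeff_of_mem_altCone (wkschur_succ_mem_altCone hlam hz.1 hz.2 hstrict)
  exact ⟨b, hfin, hsupp, hsum, fun μ _ => hsign μ⟩

end
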